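/- For every h, γ, η > 0, d ≥ 1, and κ ≥ 1, setting ζ = hγ: E_pos ≤ sqrt(4/15)·d^{1/2}·κ·η^{1/2}·γ·h² and E_mom ≤ (4/√3)·d^{1/2}·κ·η^{1/2}·h (underdamped-regime bounds on the asymptotic-bias terms). -/

import Mathlib

noncomputable section

open Real

/-- `f_pos(ζ) = ζ² − 3 + exp(−2ζ)(3 + 6ζ + 5ζ² + 2ζ³)`. -/
def fpos (ζ : ℝ) : ℝ :=
  ζ ^ 2 - 3 + Real.exp (-2 * ζ) * (3 + 6 * ζ + 5 * ζ ^ 2 + 2 * ζ ^ 3)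

/-- `f_mom(ζ) = 1 − exp(−2ζ)(1 + 2ζ + 2ζ²)`. -/
def fmom (ζ : ℝ) : ℝ := 1 - Real.exp (-2 * ζ) * (1 + 2 * ζ + 2 * ζ ^ 2)

/-- `E_pos = sqrt((1/2)·(dκ²η/γ²)·(1/ζ)·f_pos(ζ))` with `ζ = hγ`. -/
def Epos (d : ℕ) (κ η γ h : ℝ) : ℝ :=
  Real.sqrt ((1/2) * ((d : ℝ) * κ ^ 2 * η / γ ^ 2) * (1 / (h * γ)) * fpos (h * γ))

/-- `E_mom = sqrt(4·(dκ²η/γ²)·(1/ζ)·f_mom(ζ))` with `ζ = hγ`. -/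
def Emom (d : ℕ) (κ η γ h : ℝ) : ℝ :=
  Real.sqrt (4 * ((d : ℝ) * κ ^ 2 * η / γ ^ 2) * (1 / (h * γ)) * fmom (h * γ))

theorem hasDerivAt_exp_neg_two_mul (x : ℝ) :
    HasDerivAt (fun y : ℝ => Real.exp (-2 * y)) (Real.exp (-2 * x) * -2) x := by
  simpa using ((hasDerivAt_id x).const_mul (-2)).exp

theorem hasDerivAt_fmom (x : ℝ) : HasDerivAt fmom (4 * x ^ 2 * Real.exp (-2 * x)) x := by
  have hp : HasDerivAt (fun y : ℝ => 1 + 2 * y + 2 * y ^ 2) (2 + 4 * x) x := by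
    refine ((((hasDerivAt_id x).const_mul 2).const_add 1).add
      ((hasDerivAt_pow 2 x).const_mul 2)).congr_deriv ?_
    norm_num
    ring
  refine (((hasDerivAt_exp_neg_two_mul x).mul hp).const_sub 1).congr_deriv ?_
  ring

theorem hasDerivAt_fpos (x : ℝ) : HasDerivAt fpos (2 * x * fmom x) x := by
  have hp : HasDerivAt (fun y : ℝ => 3 + 6 * y + 5 * y ^ 2 + 2 * y ^ 3)
      (6 + 10 * x + 6 * x ^ 2) x := by
    refine (((((hasDerivAt_id x).const_mul 6).const_add 3).add
      ((hasDerivAt_pow 2 x).const_mul 5)).add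
      ((hasDerivAt_pow 3 x).const_mul 2)).congr_deriv ?_
    norm_num
    ring
  refine (((hasDerivAt_pow 2 x).sub_const 3).add
    ((hasDerivAt_exp_neg_two_mul x).mul hp)).congr_deriv ?_
  norm_num [fmom]
  ring

theorem le_of_hasDerivAt_le {f g f' g' : ℝ → ℝ} (hf : ∀ x, HasDerivAt f (f' x) x)
    (hg : ∀ x, HasDerivAt g (g' x) x) (h0 : f 0 ≤ g 0) (h : ∀ x, 0 ≤ x → f' x ≤ g' x)
    {x : ℝ} (hx : 0 ≤ x) : f x ≤ g x :=
  image_le_of_deriv_right_le_deriv_boundary (a := 0) (b := x)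
    (fun y _ => (hf y).continuousAt.continuousWithinAt)
    (fun y _ => (hf y).hasDerivWithinAt) h0
    (fun y _ => (hg y).continuousAt.continuousWithinAt)
    (fun y _ => (hg y).hasDerivWithinAt) (fun y hy => h y hy.1) ⟨hx, le_rfl⟩

theorem fmom_le {x : ℝ} (hx : 0 ≤ x) : fmom x ≤ 4 / 3 * x ^ 3 := by
  refine le_of_hasDerivAt_le hasDerivAt_fmom
    (fun y => (hasDerivAt_pow 3 y).const_mul (4 / 3)) (by simp [fmom]) (fun y hy => ?_) hx
  have he : Real.exp (-(2 * y)) ≤ 1 := Real.exp_le_one_iff.2 (by linarith)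
  norm_num
  nlinarith [mul_le_mul_of_nonneg_left he (sq_nonneg y)]

theorem fpos_le {x : ℝ} (hx : 0 ≤ x) : fpos x ≤ 8 / 15 * x ^ 5 := by
  refine le_of_hasDerivAt_le hasDerivAt_fpos
    (fun y => (hasDerivAt_pow 5 y).const_mul (8 / 15)) (by simp [fpos]) (fun y hy => ?_) hx
  norm_num
  nlinarith [mul_le_mul_of_nonneg_left (fmom_le hy) hy]

/-- Underdamped-regime bounds on the asymptotic-bias terms:
for every `h, γ, η > 0`, `d ≥ 1`, `κ ≥ 1`,
`E_pos ≤ sqrt(4/15)·d^{1/2}·κ·η^{1/2}·γ·h²` and `E_mom ≤ (4/√3)·d^{1/2}·κ·η^{1/2}·h`. -/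
theorem bias_bounds_underdamped (h γ η : ℝ) (hh : 0 < h) (hγ : 0 < γ) (hη : 0 < η)
    (d : ℕ) (hd : 1 ≤ d) (κ : ℝ) (hκ : 1 ≤ κ) :
    Epos d κ η γ h ≤ Real.sqrt (4/15) * Real.sqrt d * κ * Real.sqrt η * γ * h ^ 2 ∧
    Emom d κ η γ h ≤ (4 / Real.sqrt 3) * Real.sqrt d * κ * Real.sqrt η * h := by
  have hζ : 0 < h * γ := mul_pos hh hγ
  have hκ0 : 0 ≤ κ := by linarith
  constructor
  · refine Real.sqrt_le_iff.2 ⟨by positivity, ?_⟩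
    calc _ ≤ (1/2) * ((d : ℝ) * κ ^ 2 * η / γ ^ 2) * (1 / (h * γ)) * (8 / 15 * (h * γ) ^ 5) := by
          gcongr
          exact fpos_le hζ.le
      _ = 4 / 15 * d * κ ^ 2 * η * γ ^ 2 * (h ^ 2) ^ 2 := by
          field_simp
          ring
      _ = _ := by
          simp only [mul_pow]
          rw [Real.sq_sqrt (by norm_num), Real.sq_sqrt (Nat.cast_nonneg d), Real.sq_sqrt hη.le]
  · refine Real.sqrt_le_iff.2 ⟨by positivity, ?_⟩
    calc _ ≤ 4 * ((d : ℝ) * κ ^ 2 * η / γ ^ 2) * (1 / (h * γ)) * (4 / 3 * (h * γ) ^ 3) := by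
          gcongr
          exact fmom_le hζ.le
      _ = 4 ^ 2 / 3 * d * κ ^ 2 * η * h ^ 2 := by
          field_simp
      _ = _ := by
          simp only [mul_pow, div_pow]
          rw [Real.sq_sqrt (by norm_num), Real.sq_sqrt (Nat.cast_nonneg d), Real.sq_sqrt hη.le]
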